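/- arXiv:1510.03605 — 11 statements merged into one kernel-verified Lean document; each statement's English description precedes it below -/
import Mathlib

section
/- Let D(Γ) be the set of distinct vertex degrees of Γ. Then |D(Γ)| ≤ min{[G:H], |H|+2}, and furthermore min{[G:H], |H|+2} ≤ ⌊√(|G|+1)⌋ + 1. -/
open scoped Pointwise

/-- The relative Cayley graph `Cay(G, H, C)`: vertices are the elements of `G`, and distinct
vertices `x`, `y` are adjacent iff (`x ∈ H` or `y ∈ H`) and `x⁻¹ * y ∈ C`, where `C` is an
inverse-closed subset of `G \ {1}`. -/
def relCayley {G : Type*} [Group G] (H : Subgroup G) (C : Set G)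
    (hC : ∀ c ∈ C, c⁻¹ ∈ C) : SimpleGraph G where
  Adj x y := x ≠ y ∧ (x ∈ H ∨ y ∈ H) ∧ x⁻¹ * y ∈ C
  symm := by
    constructor
    rintro x y ⟨h1, h2, h3⟩
    exact ⟨h1.symm, h2.symm, by simpa using hC _ h3⟩
  loopless := ⟨fun x h => h.1 rfl⟩


/-- Left multiplication by an element of `H` is an automorphism of `Cay(G, H, C)`. -/
lemma relCayley_neighborSet_mul {G : Type*} [Group G] (H : Subgroup G) (C : Set G)
    (hC : ∀ c ∈ C, c⁻¹ ∈ C) {h : G} (hh : h ∈ H) (x : G) :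
    (relCayley H C hC).neighborSet (h * x) = h • (relCayley H C hC).neighborSet x := by
  ext y
  have hx : x ≠ h⁻¹ * y ↔ h * x ≠ y := by rw [Ne, Ne, eq_inv_mul_iff_mul_eq]
  simp [Set.mem_smul_set_iff_inv_smul_mem, relCayley, hx, H.mul_mem_cancel_left hh,
    H.mul_mem_cancel_left (H.inv_mem hh), mul_assoc]

/-- The degree is constant on right cosets of `H`. -/
lemma relCayley_ncard_neighborSet_mul {G : Type*} [Group G] (H : Subgroup G) (C : Set G)
    (hC : ∀ c ∈ C, c⁻¹ ∈ C) {h : G} (hh : h ∈ H) (x : G) :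
    ((relCayley H C hC).neighborSet (h * x)).ncard =
      ((relCayley H C hC).neighborSet x).ncard := by
  rw [relCayley_neighborSet_mul H C hC hh, Set.ncard_smul_set]

/-- A vertex outside `H` is adjacent only to elements of `H`. -/
lemma relCayley_ncard_neighborSet_le {G : Type*} [Group G] [Finite G] (H : Subgroup G)
    (C : Set G) (hC : ∀ c ∈ C, c⁻¹ ∈ C) {x : G} (hx : x ∉ H) :
    ((relCayley H C hC).neighborSet x).ncard ≤ Nat.card H := by
  rw [← SetLike.coe_sort_coe, Nat.card_coe_set_eq]
  exact Set.ncard_le_ncard (fun y hy => hy.2.1.resolve_left hx)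

lemma ncard_range_degree_le_index {G : Type*} [Group G] [Finite G] (H : Subgroup G)
    (C : Set G) (hC : ∀ c ∈ C, c⁻¹ ∈ C) :
    (Set.range fun x : G => ((relCayley H C hC).neighborSet x).ncard).ncard ≤ H.index := by
  set f := fun x : G => ((relCayley H C hC).neighborSet x).ncard
  let g : G ⧸ H → ℕ := fun q => f q.out⁻¹
  have hsub : Set.range f ⊆ Set.range g := by
    rintro _ ⟨x, rfl⟩
    obtain ⟨h, hh⟩ := QuotientGroup.mk_out_eq_mul H x⁻¹
    refine ⟨(x⁻¹ : G), ?_⟩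
    simp only [g, hh, mul_inv_rev, inv_inv]
    exact relCayley_ncard_neighborSet_mul H C hC (H.inv_mem h.2) x
  calc (Set.range f).ncard ≤ (Set.range g).ncard := Set.ncard_le_ncard hsub
    _ ≤ Nat.card (G ⧸ H) := by
      rw [← Set.image_univ, ← Set.ncard_univ]
      exact Set.ncard_image_le
    _ = H.index := rfl

lemma ncard_range_degree_le_card_add_two {G : Type*} [Group G] [Finite G] (H : Subgroup G)
    (C : Set G) (hC : ∀ c ∈ C, c⁻¹ ∈ C) :
    (Set.range fun x : G => ((relCayley H C hC).neighborSet x).ncard).ncard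
      ≤ Nat.card H + 2 := by
  have hsub : (Set.range fun x : G => ((relCayley H C hC).neighborSet x).ncard) ⊆
      insert ((relCayley H C hC).neighborSet 1).ncard (Finset.range (Nat.card H + 1) : Set ℕ) := by
    rintro _ ⟨x, rfl⟩
    by_cases hx : x ∈ H
    · left
      simpa using relCayley_ncard_neighborSet_mul H C hC hx 1
    · right
      simpa [Nat.lt_succ_iff] using relCayley_ncard_neighborSet_le H C hC hx
  refine (Set.ncard_le_ncard hsub ((Finset.finite_toSet _).insert _)).trans ?_
  refine (Set.ncard_insert_le _ _).trans ?_
  rw [Set.ncard_coe_finset, Finset.card_range]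

lemma min_add_two_le_sqrt (a b : ℕ) : min a (b + 2) ≤ Nat.sqrt (b * a + 1) + 1 := by
  rw [← Nat.sub_le_iff_le_add, Nat.le_sqrt]
  have ha : min a (b + 2) ≤ a := min_le_left _ _
  have hb : min a (b + 2) ≤ b + 2 := min_le_right _ _
  generalize min a (b + 2) = n at ha hb
  rcases n with _ | _ | n
  · simp
  · simp
  · have : n * (n + 2) ≤ b * a := Nat.mul_le_mul (by omega) ha
    simp only [Nat.add_sub_cancel]
    nlinarith

/-- Theorem 2.2: the number of distinct vertex degrees of `Γ = Cay(G,H,C)` is at most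
`min([G:H], |H| + 2)`, which in turn is at most `⌊√(|G|+1)⌋ + 1`. -/
theorem statement1 {G : Type*} [Group G] [Finite G] (H : Subgroup G) (hH : H ≠ ⊤)
    (C : Set G) (h1 : (1 : G) ∉ C) (hC : ∀ c ∈ C, c⁻¹ ∈ C) :
    (Set.range fun x : G => ((relCayley H C hC).neighborSet x).ncard).ncard
        ≤ min H.index (Nat.card H + 2) ∧
      min H.index (Nat.card H + 2) ≤ Nat.sqrt (Nat.card G + 1) + 1 := by
  refine ⟨le_min (ncard_range_degree_le_index H C hC)
    (ncard_range_degree_le_card_add_two H C hC), ?_⟩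
  rw [← H.card_mul_index]
  exact min_add_two_le_sqrt _ _
end

section
/- The number of edges of Γ satisfies 2·|E(Γ)| = |H|·(2|C| − |H∩C|). -/
open scoped Pointwise

/-- The pairs `(h, h * s)` with `h ∈ H` and `s ∈ S` number `|H| * |S|`. -/
lemma ncard_setOf_mem_inv_mul_mem {G : Type*} [Group G] (H : Subgroup G) (S : Set G) :
    {p : G × G | p.1 ∈ H ∧ p.1⁻¹ * p.2 ∈ S}.ncard = Nat.card H * S.ncard := by
  have himage : {p : G × G | p.1 ∈ H ∧ p.1⁻¹ * p.2 ∈ S}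
      = (fun p : G × G => (p.1, p.1 * p.2)) '' ((H : Set G) ×ˢ S) := by
    ext ⟨x, y⟩
    constructor
    · rintro ⟨hx, hy⟩
      exact ⟨(x, x⁻¹ * y), ⟨hx, hy⟩, by simp⟩
    · rintro ⟨⟨h, s⟩, ⟨hh, hs⟩, heq⟩
      obtain ⟨rfl, rfl⟩ := Prod.mk.inj heq
      exact ⟨hh, by simpa using hs⟩
  have hinj : Function.Injective (fun p : G × G => (p.1, p.1 * p.2)) := by
    rintro ⟨a, b⟩ ⟨c, d⟩ heq
    obtain ⟨rfl, h⟩ := Prod.mk.inj heq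
    simpa using h
  rw [himage, Set.ncard_image_of_injective _ hinj, Set.ncard_prod]
  rfl

/-- Twice the number of edges of a finite simple graph is its number of adjacent ordered pairs. -/
lemma SimpleGraph.two_mul_ncard_edgeSet {V : Type*} [Finite V] (Γ : SimpleGraph V) :
    2 * Γ.edgeSet.ncard = {p : V × V | Γ.Adj p.1 p.2}.ncard := by
  classical
  have := Fintype.ofFinite V
  have hdart : {p : V × V | Γ.Adj p.1 p.2} = Set.range (SimpleGraph.Dart.toProd (G := Γ)) := by
    ext p
    exact ⟨fun h => ⟨⟨p, h⟩, rfl⟩, by rintro ⟨d, rfl⟩; exact d.adj⟩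
  rw [hdart, ← Set.image_univ,
    Set.ncard_image_of_injective _ SimpleGraph.Dart.toProd_injective, Set.ncard_univ,
    Nat.card_eq_fintype_card, Γ.dart_card_eq_twice_card_edges, ← Γ.coe_edgeFinset,
    Set.ncard_coe_finset]

/-- Lemma 2.5: `2 |E(Γ)| = |H| (2|C| - |H ∩ C|)` for the relative Cayley graph
`Γ = Cay(G,H,C)`. -/
theorem statement2 {G : Type*} [Group G] [Finite G] (H : Subgroup G) (hH : H ≠ ⊤)
    (C : Set G) (h1 : (1 : G) ∉ C) (hC : ∀ c ∈ C, c⁻¹ ∈ C) :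
    2 * ((relCayley H C hC).edgeSet).ncard
      = Nat.card H * (2 * C.ncard - ((H : Set G) ∩ C).ncard) := by
  set A : Set (G × G) := {p | p.1 ∈ H ∧ p.1⁻¹ * p.2 ∈ C} with hA
  set B : Set (G × G) := Prod.swap '' A with hB
  have memB (x y : G) : (x, y) ∈ B ↔ y ∈ H ∧ x⁻¹ * y ∈ C := by
    rw [hB, Set.image_swap_eq_preimage_swap]
    exact and_congr_right fun _ =>
      ⟨fun h => by simpa using hC _ h, fun h => by simpa using hC _ h⟩
  have hadj : {p : G × G | (relCayley H C hC).Adj p.1 p.2} = A ∪ B := by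
    ext ⟨x, y⟩
    rw [Set.mem_union, memB]
    change (x ≠ y ∧ (x ∈ H ∨ y ∈ H) ∧ x⁻¹ * y ∈ C) ↔
      (x ∈ H ∧ x⁻¹ * y ∈ C) ∨ (y ∈ H ∧ x⁻¹ * y ∈ C)
    have hne : x⁻¹ * y ∈ C → x ≠ y := by
      rintro h rfl
      exact h1 (by simpa using h)
    tauto
  have hinter : A ∩ B = {p : G × G | p.1 ∈ H ∧ p.1⁻¹ * p.2 ∈ (H : Set G) ∩ C} := by
    ext ⟨x, y⟩
    rw [Set.mem_inter_iff, memB]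
    change (x ∈ H ∧ x⁻¹ * y ∈ C) ∧ y ∈ H ∧ x⁻¹ * y ∈ C ↔
      x ∈ H ∧ x⁻¹ * y ∈ H ∧ x⁻¹ * y ∈ C
    have hmem : x ∈ H → (x⁻¹ * y ∈ H ↔ y ∈ H) :=
      fun hx => H.mul_mem_cancel_left (H.inv_mem hx)
    tauto
  have hcard := Set.ncard_union_add_ncard_inter A B
  rw [hinter, ncard_setOf_mem_inv_mul_mem, hB,
    Set.ncard_image_of_injective _ Prod.swap_injective, ← hB, hA,
    ncard_setOf_mem_inv_mul_mem, ← hA, ← hadj] at hcard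
  rw [SimpleGraph.two_mul_ncard_edgeSet, Nat.mul_sub, mul_left_comm]
  omega
end

section
/- Let x ∈ G∖H. Then deg_Γ(x) = |C| if and only if x ∈ ⋂_{c∈C} Hc (the intersection of the right cosets Hc over all c ∈ C). -/
open scoped Pointwise

/-- A vertex `x ∉ H` is adjacent exactly to the elements `x * c ∈ H` with `c ∈ C`. -/
theorem relCayley_neighborSet_of_notMem {G : Type*} [Group G] (H : Subgroup G) (C : Set G)
    (h1 : (1 : G) ∉ C) (hC : ∀ c ∈ C, c⁻¹ ∈ C) {x : G} (hx : x ∉ H) :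
    (relCayley H C hC).neighborSet x = (x * ·) '' {c ∈ C | x * c ∈ H} := by
  ext y
  constructor
  · rintro ⟨-, hH, hc⟩
    exact ⟨x⁻¹ * y, ⟨hc, by simpa using hH.resolve_left hx⟩, by simp⟩
  · rintro ⟨c, ⟨hc, hH⟩, rfl⟩
    refine ⟨fun h => h1 ?_, Or.inr hH, by simpa using hc⟩
    rwa [left_eq_mul.mp h] at hc

/-- Lemma 2.7: for `x ∈ G \ H`, the degree of `x` in `Γ = Cay(G,H,C)` equals `|C|` iff
`x` lies in the intersection of the right cosets `Hc`, `c ∈ C`. -/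
theorem statement4 {G : Type*} [Group G] [Finite G] (H : Subgroup G) (hH : H ≠ ⊤)
    (C : Set G) (h1 : (1 : G) ∉ C) (hC : ∀ c ∈ C, c⁻¹ ∈ C) (x : G) (hx : x ∉ H) :
    ((relCayley H C hC).neighborSet x).ncard = C.ncard ↔
      x ∈ ⋂ c ∈ C, (fun h : G => h * c) '' (H : Set G) := by
  rw [relCayley_neighborSet_of_notMem H C h1 hC hx,
    Set.ncard_image_of_injective _ (mul_right_injective x)]
  trans ∀ c ∈ C, x * c ∈ H
  · rw [← Set.sep_eq_self_iff_mem_true]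
    exact ⟨fun h => Set.eq_of_subset_of_ncard_le (Set.sep_subset _ _) h.ge,
      fun h => congrArg Set.ncard h⟩
  · simp only [Set.mem_iInter, Set.image_mul_right, Set.mem_preimage, SetLike.mem_coe]
    exact ⟨fun h c hc => h _ (hC c hc), fun h c hc => by simpa using h _ (hC c hc)⟩
end

section
/- Γ is semi-regular (i.e., its vertices take exactly two distinct degrees) if and only if one of the following holds: (i) there exists δ ≠ |C| such that |gH ∩ C| = δ for every g ∈ G∖H (C has the same number of elements in every left coset of H different from H, and this common number differs from |C|), or (ii) C ≠ ∅, C ⊆ Hc for some c ∈ C∖H (C falls in a single right coset of H different from H), and [G:H] ≥ 3. -/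
open scoped Pointwise

section RelCayley

variable {G : Type*} [Group G] (H : Subgroup G) (C : Set G)

theorem mem_mul_left_image_iff {g y : G} :
    y ∈ (g * ·) '' (H : Set G) ↔ g⁻¹ * y ∈ H := by
  constructor
  · rintro ⟨h, hh, rfl⟩
    simpa using hh
  · intro h
    exact ⟨_, h, by simp⟩

theorem mem_mul_right_image_iff {c y : G} :
    y ∈ (fun h : G => h * c) '' (H : Set G) ↔ y * c⁻¹ ∈ H := by
  constructor
  · rintro ⟨h, hh, rfl⟩
    simpa using hh
  · intro h
    exact ⟨_, h, by simp⟩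

theorem mul_left_image_eq_of_inv_mul_mem {g g' : G} (h : g⁻¹ * g' ∈ H) :
    (g * ·) '' (H : Set G) = (g' * ·) '' (H : Set G) := by
  ext y
  rw [mem_mul_left_image_iff, mem_mul_left_image_iff, ← H.mul_mem_cancel_left (y := g'⁻¹ * y) h]
  simp [mul_assoc]

theorem mul_left_image_inter_eq_empty {g g' : G} (hC : C ⊆ (g * ·) '' (H : Set G))
    (h : g⁻¹ * g' ∉ H) : (g' * ·) '' (H : Set G) ∩ C = ∅ := by
  refine Set.eq_empty_of_forall_notMem fun y ⟨hy, hyC⟩ => h ?_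
  have hy' := (mem_mul_left_image_iff H).1 hy
  have := H.mul_mem ((mem_mul_left_image_iff H).1 (hC hyC)) (H.inv_mem hy')
  simpa [mul_assoc] using this

theorem relCayley_ncard_neighborSet_of_mem (h1 : (1 : G) ∉ C) (hC : ∀ c ∈ C, c⁻¹ ∈ C) {x : G}
    (hx : x ∈ H) : ((relCayley H C hC).neighborSet x).ncard = C.ncard := by
  have : (relCayley H C hC).neighborSet x = (x * ·) '' C := by
    ext y
    simp only [SimpleGraph.mem_neighborSet, relCayley, Set.mem_image]
    constructor
    · rintro ⟨-, -, h⟩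
      exact ⟨_, h, by simp⟩
    · rintro ⟨c, hc, rfl⟩
      refine ⟨fun h => h1 ?_, Or.inl hx, by simpa using hc⟩
      rwa [← left_eq_mul.1 h]
  rw [this, Set.ncard_image_of_injective _ (mul_right_injective x)]

theorem relCayley_ncard_neighborSet_of_notMem (hC : ∀ c ∈ C, c⁻¹ ∈ C) {x : G} (hx : x ∉ H) :
    ((relCayley H C hC).neighborSet x).ncard = ((x⁻¹ * ·) '' (H : Set G) ∩ C).ncard := by
  have : (relCayley H C hC).neighborSet x = (x * ·) '' ((x⁻¹ * ·) '' (H : Set G) ∩ C) := by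
    ext y
    simp only [SimpleGraph.mem_neighborSet, relCayley, Set.mem_image, Set.mem_inter_iff]
    constructor
    · rintro ⟨-, h, hy⟩
      exact ⟨_, ⟨⟨y, h.resolve_left hx, rfl⟩, hy⟩, by simp⟩
    · rintro ⟨_, ⟨⟨h, hh, rfl⟩, hc⟩, rfl⟩
      simp only [mul_inv_cancel_left]
      exact ⟨fun e => hx (e ▸ hh), Or.inr hh, hc⟩
  rw [this, Set.ncard_image_of_injective _ (mul_right_injective x)]

/-- The degrees of `Cay(G, H, C)` are `|C|` and the numbers `|gH ∩ C|` for `g ∉ H`. -/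
theorem relCayley_range_ncard_neighborSet (h1 : (1 : G) ∉ C) (hC : ∀ c ∈ C, c⁻¹ ∈ C) :
    (Set.range fun x : G => ((relCayley H C hC).neighborSet x).ncard) =
      insert C.ncard ((fun g : G => ((g * ·) '' (H : Set G) ∩ C).ncard) '' (H : Set G)ᶜ) := by
  ext n
  constructor
  · rintro ⟨x, rfl⟩
    by_cases hx : x ∈ H
    · exact Or.inl (relCayley_ncard_neighborSet_of_mem H C h1 hC hx)
    · exact Or.inr ⟨x⁻¹, by simpa using hx,
        (relCayley_ncard_neighborSet_of_notMem H C hC hx).symm⟩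
  · rintro (rfl | ⟨g, hg, rfl⟩)
    · exact ⟨1, relCayley_ncard_neighborSet_of_mem H C h1 hC H.one_mem⟩
    · refine ⟨g⁻¹, ?_⟩
      have hg' : g⁻¹ ∉ H := by simpa using hg
      simpa using relCayley_ncard_neighborSet_of_notMem H C hC hg'

theorem three_le_index_iff [Finite G] {g : G} (hg : g ∉ H) :
    3 ≤ H.index ↔ ∃ g', g' ∉ H ∧ g⁻¹ * g' ∉ H := by
  have hne : ((1 : G) : G ⧸ H) ≠ g := fun h => hg (by simpa using QuotientGroup.eq.1 h)
  rw [Subgroup.index, ← Set.ncard_univ]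
  constructor
  · intro h
    by_contra! hcon
    have hsub : (Set.univ : Set (G ⧸ H)) ⊆ {((1 : G) : G ⧸ H), (g : G ⧸ H)} := by
      rintro q -
      induction q using QuotientGroup.induction_on with
      | H z =>
        by_cases hz : z ∈ H
        · exact Or.inl (QuotientGroup.eq.2 (by simpa using hz))
        · exact Or.inr (QuotientGroup.eq.2 (hcon z hz)).symm
    have := Set.ncard_le_ncard hsub
    rw [Set.ncard_pair hne] at this
    omega
  · rintro ⟨g', hg', hgg'⟩
    refine (Set.two_lt_ncard).2 ⟨((1 : G) : G ⧸ H), trivial, g, trivial, g', trivial, hne, ?_, ?_⟩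
    · exact fun h => hg' (by simpa using QuotientGroup.eq.1 h)
    · exact fun h => hgg' (QuotientGroup.eq.1 h)

end RelCayley

/-- Theorem 2.8: the relative Cayley graph `Γ = Cay(G,H,C)` is semi-regular (its vertices take
exactly two distinct degrees) iff either (i) `C` meets every left coset `gH ≠ H` in the same
number `δ ≠ |C|` of elements, or (ii) `C` is nonempty, lies in a single right coset `Hc ≠ H`
with `c ∈ C \ H`, and `[G:H] ≥ 3`. -/
theorem statement5 {G : Type*} [Group G] [Finite G] (H : Subgroup G) (hH : H ≠ ⊤)
    (C : Set G) (h1 : (1 : G) ∉ C) (hC : ∀ c ∈ C, c⁻¹ ∈ C) :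
    (Set.range fun x : G => ((relCayley H C hC).neighborSet x).ncard).ncard = 2 ↔
      ((∃ δ : ℕ, δ ≠ C.ncard ∧ ∀ g : G, g ∉ H → (((g * ·) '' (H : Set G)) ∩ C).ncard = δ) ∨
        (C.Nonempty ∧ (∃ c ∈ C, c ∉ H ∧ C ⊆ (fun h : G => h * c) '' (H : Set G)) ∧
          3 ≤ H.index)) := by
  have hdeg := relCayley_range_ncard_neighborSet H C h1 hC
  obtain ⟨g₀, hg₀⟩ : ∃ g, g ∉ H := by
    by_contra! h
    exact hH ((Subgroup.eq_top_iff' H).2 h)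
  rw [hdeg]
  constructor
  · intro h
    obtain ⟨δ, hδ, hS⟩ : ∃ δ, δ ≠ C.ncard ∧
        insert C.ncard ((fun g : G => ((g * ·) '' (H : Set G) ∩ C).ncard) '' (H : Set G)ᶜ) =
          {C.ncard, δ} := by
      obtain ⟨a, b, hab, hS⟩ := Set.ncard_eq_two.1 h
      rcases hS ▸ Set.mem_insert C.ncard _ with ha | hb
      · exact ⟨b, by rw [ha]; exact hab.symm, by rw [hS, ha]⟩
      · rw [Set.mem_singleton_iff] at hb
        exact ⟨a, by rw [hb]; exact hab, by rw [hS, hb, Set.pair_comm]⟩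
    by_cases hfull : ∃ g, g ∉ H ∧ ((g * ·) '' (H : Set G) ∩ C).ncard = C.ncard
    · right
      obtain ⟨g, hg, hgC⟩ := hfull
      have hCg : C ⊆ (g * ·) '' (H : Set G) :=
        Set.inter_eq_right.1 (Set.eq_of_subset_of_ncard_le Set.inter_subset_right hgC.ge)
      obtain ⟨g', hg', hδ'⟩ : δ ∈ (fun g : G => ((g * ·) '' (H : Set G) ∩ C).ncard) ''
          (H : Set G)ᶜ := by
        have hmem : δ ∈ ({C.ncard, δ} : Set ℕ) := Or.inr rfl
        rw [← hS] at hmem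
        exact hmem.resolve_left hδ
      have hne : C.Nonempty := by
        rw [Set.nonempty_iff_ne_empty]
        rintro rfl
        exact hδ (by simp [← hδ'])
      refine ⟨hne, ?_, (three_le_index_iff H hg).2 ⟨g', hg', fun hgg' => hδ ?_⟩⟩
      · obtain ⟨c, hc⟩ := hne
        have hcos : ∀ y ∈ C, g⁻¹ * y ∈ H := fun y hy => (mem_mul_left_image_iff H).1 (hCg hy)
        refine ⟨c, hc, fun hcH => hg ?_, fun y hy => (mem_mul_right_image_iff H).2 ?_⟩
        · simpa using (H.mul_mem_cancel_right hcH).1 (hcos c hc)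
        · simpa [mul_assoc] using
            H.mul_mem (H.inv_mem (hcos _ (hC y hy))) (hcos _ (hC c hc))
      · rw [← hδ', ← hgC, mul_left_image_eq_of_inv_mul_mem H hgg']
    · left
      refine ⟨δ, hδ, fun g hg => ?_⟩
      have hmem : ((g * ·) '' (H : Set G) ∩ C).ncard ∈ ({C.ncard, δ} : Set ℕ) :=
        hS ▸ Or.inr ⟨g, hg, rfl⟩
      exact hmem.resolve_left fun h => hfull ⟨g, hg, h⟩
  · rintro (⟨δ, hδ, hd⟩ | ⟨hne, ⟨c, hc, hcH, hCc⟩, hindex⟩)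
    · rw [← Set.ncard_pair hδ.symm]
      congr 2
      ext n
      constructor
      · rintro ⟨g, hg, rfl⟩
        exact hd g hg
      · rintro rfl
        exact ⟨g₀, hg₀, hd g₀ hg₀⟩
    · have hcH' : c⁻¹ ∉ H := by simpa using hcH
      have hCc' : C ⊆ (c⁻¹ * ·) '' (H : Set G) := fun y hy => by
        rw [mem_mul_left_image_iff]
        simpa using H.inv_mem ((mem_mul_right_image_iff H).1 (hCc (hC y hy)))
      obtain ⟨g', hg', hcg'⟩ := (three_le_index_iff H hcH').1 hindex
      have hpos : C.ncard ≠ 0 := ((Set.ncard_pos C.toFinite).2 hne).ne'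
      rw [← Set.ncard_pair hpos]
      congr 1
      ext n
      constructor
      · rintro (rfl | ⟨g, hg, rfl⟩)
        · exact Or.inl rfl
        · by_cases hcg : c⁻¹⁻¹ * g ∈ H
          · left
            simp only [← mul_left_image_eq_of_inv_mul_mem H hcg, Set.inter_eq_right.2 hCc']
          · right
            simp only [mul_left_image_inter_eq_empty H C hCc' hcg, Set.ncard_empty,
              Set.mem_singleton_iff]
      · rintro (rfl | rfl)
        · exact Or.inl rfl
        · exact Or.inr ⟨g', hg', by
            simp only [mul_left_image_inter_eq_empty H C hCc' hcg', Set.ncard_empty]⟩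
end

section
/- Suppose H ∩ C = ∅. Then Γ is connected if and only if G = HC* and H = ⟨H ∩ C²⟩. -/
open scoped Pointwise

section RelCayley

variable {G : Type*} [Group G] {H : Subgroup G} {C : Set G} {hC : ∀ c ∈ C, c⁻¹ ∈ C}

theorem relCayley_adj_mul_right {x c : G} (hx : x ∈ H ∨ x * c ∈ H) (hc : c ∈ C)
    (h1 : (1 : G) ∉ C) : (relCayley H C hC).Adj x (x * c) := by
  refine ⟨fun h => h1 ?_, hx, by simpa using hc⟩
  rwa [← left_eq_mul.mp h]

/-- If `C` misses `H`, every vertex reachable from `1` lies in `⟨H ∩ C²⟩ C*`. -/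
theorem mem_closure_mul_of_reachable_one (hHC : (H : Set G) ∩ C = ∅) {x : G}
    (hx : (relCayley H C hC).Reachable 1 x) :
    x ∈ (Subgroup.closure ((H : Set G) ∩ (C * C)) : Set G) * insert (1 : G) C := by
  have hKH : Subgroup.closure ((H : Set G) ∩ (C * C)) ≤ H :=
    (Subgroup.closure_le H).mpr Set.inter_subset_left
  rw [SimpleGraph.reachable_iff_reflTransGen] at hx
  induction hx with
  | refl => exact ⟨1, one_mem _, 1, Set.mem_insert _ _, mul_one 1⟩
  | @tail x y _ hxy ih =>
    obtain ⟨-, hmem, hc'⟩ := hxy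
    obtain ⟨k, hk, c, rfl | hc, rfl⟩ := ih
    · exact ⟨k, hk, k⁻¹ * y, Or.inr (by simpa using hc'), mul_inv_cancel_left k y⟩
    · have hcH : c ∉ H := fun h => hHC.le ⟨h, hc⟩
      have hy : y ∈ H := hmem.resolve_left fun h => hcH ((H.mul_mem_cancel_left (hKH hk)).mp h)
      have hgen : k⁻¹ * y ∈ Subgroup.closure ((H : Set G) ∩ (C * C)) :=
        Subgroup.subset_closure
          ⟨H.mul_mem (H.inv_mem (hKH hk)) hy, c, hc, _, hc', by simp [mul_assoc]⟩
      exact ⟨y, by simpa using mul_mem hk hgen, 1, Set.mem_insert _ _, mul_one y⟩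

theorem relCayley_reachable_mul_of_mem_closure (h1 : (1 : G) ∉ C) {h : G}
    (hh : h ∈ Subgroup.closure ((H : Set G) ∩ (C * C))) {x : G} (hx : x ∈ H) :
    (relCayley H C hC).Reachable x (x * h) := by
  have hKH : Subgroup.closure ((H : Set G) ∩ (C * C)) ≤ H :=
    (Subgroup.closure_le H).mpr Set.inter_subset_left
  induction hh using Subgroup.closure_induction generalizing x with
  | mem h hh =>
    obtain ⟨hhH, c, hc, d, hd, rfl⟩ := hh
    have hxcd : x * c * d ∈ H := by
      rw [mul_assoc]
      exact H.mul_mem hx hhH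
    have h₁ := relCayley_adj_mul_right (hC := hC) (Or.inl hx) hc h1
    have h₂ := relCayley_adj_mul_right (hC := hC) (Or.inr hxcd) hd h1
    simpa [mul_assoc] using h₁.reachable.trans h₂.reachable
  | one => simp
  | mul a b ha _ iha ihb =>
    rw [← mul_assoc]
    exact (iha hx).trans (ihb (H.mul_mem hx (hKH ha)))
  | inv a ha iha =>
    simpa using (iha (H.mul_mem hx (H.inv_mem (hKH ha)))).symm

end RelCayley

/-- Corollary 3.4: if `H ∩ C = ∅`, then `Γ = Cay(G,H,C)` is connected iff `G = HC*` and
`H = ⟨H ∩ C²⟩`. -/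
theorem statement8 {G : Type*} [Group G] [Finite G] (H : Subgroup G) (hH : H ≠ ⊤)
    (C : Set G) (h1 : (1 : G) ∉ C) (hC : ∀ c ∈ C, c⁻¹ ∈ C)
    (hHC : (H : Set G) ∩ C = ∅) :
    (relCayley H C hC).Connected ↔
      ((H : Set G) * insert (1 : G) C = Set.univ ∧
        H = Subgroup.closure ((H : Set G) ∩ (C * C))) := by
  have hKH : Subgroup.closure ((H : Set G) ∩ (C * C)) ≤ H :=
    (Subgroup.closure_le H).mpr Set.inter_subset_left
  constructor
  · intro hconn
    have hmem (x : G) := mem_closure_mul_of_reachable_one hHC (hconn.preconnected 1 x)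
    refine ⟨Set.eq_univ_of_forall fun x => Set.mul_subset_mul_right hKH (hmem x),
      le_antisymm (fun x hx => ?_) hKH⟩
    obtain ⟨k, hk, c, rfl | hc, rfl⟩ := hmem x
    · simpa using hk
    · have hcH : c ∈ H := (H.mul_mem_cancel_left (hKH hk)).mp hx
      exact (hHC.le ⟨hcH, hc⟩ : c ∈ (∅ : Set G)).elim
  · rintro ⟨huniv, hgen⟩
    have hreach (x : G) : (relCayley H C hC).Reachable 1 x := by
      obtain ⟨h, hh, c, hc, rfl⟩ := huniv.ge (Set.mem_univ x)
      have hh₁ : (relCayley H C hC).Reachable 1 h := by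
        simpa using relCayley_reachable_mul_of_mem_closure (hC := hC) h1 (hgen.le hh) H.one_mem
      obtain rfl | hc := hc
      · simpa using hh₁
      · exact hh₁.trans (relCayley_adj_mul_right (Or.inl hh) hc h1).reachable
    exact ⟨fun x y => (hreach x).symm.trans (hreach y)⟩
end

section
/- Suppose Γ is connected. Then diam(Γ) ≤ (3/2)|H| + 2. Moreover, if H ∩ C = ∅ then diam(Γ) ≤ |H| + 2, and if H ∩ (C∖H)² = {1} then diam(Γ) ≤ (1/2)|H| + 2. -/
open scoped Pointwise

namespace SimpleGraph

variable {V : Type*} {Γ : SimpleGraph V}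

/-- Discrete intermediate value property along a walk. -/
lemma Walk.exists_mem_support_apply_eq (f : V → ℕ) (hf : ∀ x y, Γ.Adj x y → f y ≤ f x + 1)
    {a b : V} (p : Γ.Walk a b) {i : ℕ} (ha : f a ≤ i) (hb : i ≤ f b) :
    ∃ x ∈ p.support, f x = i := by
  induction p with
  | nil => exact ⟨_, by simp, le_antisymm ha hb⟩
  | @cons a c b h p ih =>
    rcases ha.eq_or_lt with ha | ha
    · exact ⟨a, by simp, ha⟩
    · obtain ⟨x, hx, hxi⟩ := ih ((hf _ _ h).trans ha) hb
      exact ⟨x, by simp [hx], hxi⟩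

/-- A finite connected graph has a vertex that is not a cut vertex. -/
lemma Connected.exists_forall_walk_notMem_support [Finite V] (hΓ : Γ.Connected) :
    ∃ w, ∀ a b, a ≠ w → b ≠ w → ∃ p : Γ.Walk a b, w ∉ p.support := by
  classical
  have := hΓ.nonempty
  obtain ⟨u⟩ := hΓ.nonempty
  obtain ⟨w, hw⟩ := Finite.exists_max (fun x => Γ.dist u x)
  have key : ∀ a, a ≠ w → ∃ p : Γ.Walk u a, w ∉ p.support := by
    intro a ha
    obtain ⟨p, hp⟩ := hΓ.exists_walk_length_eq_dist u a
    refine ⟨p, fun hmem => ?_⟩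
    have hlen := congrArg Walk.length (p.take_spec hmem)
    rw [Walk.length_append] at hlen
    have hle := dist_le (p.takeUntil w hmem)
    have hpos : (p.dropUntil w hmem).length ≠ 0 := fun h0 =>
      ha (Walk.eq_of_length_eq_zero h0).symm
    have := hw a
    omega
  refine ⟨w, fun a b ha hb => ?_⟩
  obtain ⟨p, hp⟩ := key a ha
  obtain ⟨q, hq⟩ := key b hb
  exact ⟨p.reverse.append q, by simp [Walk.mem_support_append_iff, hp, hq]⟩

/-- A finite connected vertex-transitive graph has no cut vertex. -/
lemma Connected.exists_walk_notMem_support_of_transitive [Finite V] (hΓ : Γ.Connected)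
    (htrans : ∀ u v, ∃ φ : Γ ≃g Γ, φ u = v) {a b w : V} (ha : a ≠ w) (hb : b ≠ w) :
    ∃ p : Γ.Walk a b, w ∉ p.support := by
  obtain ⟨z, hz⟩ := hΓ.exists_forall_walk_notMem_support
  obtain ⟨φ, rfl⟩ := htrans z w
  obtain ⟨p, hp⟩ := hz (φ.symm a) (φ.symm b)
    (fun h => ha (by simp [← h])) (fun h => hb (by simp [← h]))
  refine ⟨(p.map φ.toHom).copy (by simp) (by simp), ?_⟩
  simpa using hp

/-- The diameter of a finite connected vertex-transitive graph is at most half its order. -/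
lemma Connected.two_mul_dist_le_card_of_transitive [Finite V] (hΓ : Γ.Connected)
    (htrans : ∀ u v, ∃ φ : Γ ≃g Γ, φ u = v) (u v : V) : 2 * Γ.dist u v ≤ Nat.card V := by
  classical
  have := Fintype.ofFinite V
  rw [Nat.card_eq_fintype_card]
  have hf : ∀ x y, Γ.Adj x y → Γ.dist u y ≤ Γ.dist u x + 1 := fun x y h => by
    have := hΓ.dist_triangle (u := u) (v := x) (w := y)
    rwa [dist_eq_one_iff_adj.2 h] at this
  have hsphere : ∀ i, 0 < i → i < Γ.dist u v →
      2 ≤ (Finset.univ.filter fun x => Γ.dist u x = i).card := by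
    intro i hi hid
    obtain ⟨p⟩ := hΓ u v
    obtain ⟨x, -, hx⟩ := p.exists_mem_support_apply_eq _ hf (by simp) hid.le
    obtain ⟨q, hq⟩ := hΓ.exists_walk_notMem_support_of_transitive htrans
      (a := u) (b := v) (w := x) (by rintro rfl; simp at hx; omega)
      (by rintro rfl; omega)
    obtain ⟨y, hy, hyi⟩ := q.exists_mem_support_apply_eq _ hf (by simp) hid.le
    exact Finset.one_lt_card.2 ⟨x, by simpa using hx, y, by simpa using hyi,
      by rintro rfl; exact hq hy⟩
  have hball : ∀ k, k < Γ.dist u v →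
      2 * k + 1 ≤ (Finset.univ.filter fun x => Γ.dist u x ≤ k).card := by
    intro k
    induction k with
    | zero => exact fun _ => Finset.card_pos.2 ⟨u, by simp⟩
    | succ k ih =>
      intro hk
      have hsplit : (Finset.univ.filter fun x => Γ.dist u x ≤ k + 1) =
          (Finset.univ.filter fun x => Γ.dist u x ≤ k) ∪
            (Finset.univ.filter fun x => Γ.dist u x = k + 1) := by
        ext x
        simp only [Finset.mem_filter, Finset.mem_univ, true_and, Finset.mem_union]
        omega
      rw [hsplit, Finset.card_union_of_disjoint]
      · have := ih (by omega)
        have := hsphere (k + 1) (by omega) hk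
        omega
      · refine Finset.disjoint_filter.2 fun x _ hx => ?_
        omega
  rcases Nat.eq_zero_or_pos (Γ.dist u v) with h0 | hpos
  · simp [h0]
  · have hb := hball (Γ.dist u v - 1) (by omega)
    have hlt : (Finset.univ.filter fun x => Γ.dist u x ≤ Γ.dist u v - 1).card <
        Fintype.card V := by
      refine Finset.card_lt_univ_of_notMem (x := v) ?_
      simp only [Finset.mem_filter, Finset.mem_univ, true_and]
      omega
    omega

/-- A map sending adjacent vertices to vertices at distance at most `m` multiplies distances by
at most `m`. -/
lemma Connected.dist_apply_le_mul_dist {W : Type*} {Δ : SimpleGraph W} (hΓ : Γ.Connected)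
    (hΔ : Δ.Connected) (f : W → V) {m : ℕ} (hf : ∀ x y, Δ.Adj x y → Γ.dist (f x) (f y) ≤ m)
    (x y : W) : Γ.dist (f x) (f y) ≤ m * Δ.dist x y := by
  obtain ⟨p, hp⟩ := hΔ.exists_walk_length_eq_dist x y
  rw [← hp]
  clear hp
  induction p with
  | nil => simp
  | @cons a c b h p ih =>
    calc Γ.dist (f a) (f b) ≤ Γ.dist (f a) (f c) + Γ.dist (f c) (f b) := hΓ.dist_triangle
      _ ≤ m + m * p.length := Nat.add_le_add (hf _ _ h) ih
      _ = m * (Walk.cons h p).length := by rw [Walk.length_cons]; ring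

end SimpleGraph

section RelCayley

variable {G : Type*} [Group G] {H : Subgroup G} {C : Set G} {hC : ∀ c ∈ C, c⁻¹ ∈ C}

/-- The Cayley graph on `H` whose connection set is `H ∩ (C ∪ (C \ H)²)`. -/
def shortcutGraph (H : Subgroup G) (C : Set G) (hC : ∀ c ∈ C, c⁻¹ ∈ C) : SimpleGraph H where
  Adj x y := x ≠ y ∧ (x : G)⁻¹ * y ∈ C ∪ (C \ (H : Set G)) * (C \ (H : Set G))
  symm := by
    constructor
    rintro x y ⟨hne, h⟩
    refine ⟨hne.symm, ?_⟩
    rw [show (y : G)⁻¹ * x = ((x : G)⁻¹ * y)⁻¹ by group]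
    rcases h with h | ⟨c, ⟨hc, hcH⟩, d, ⟨hd, hdH⟩, hcd⟩
    · exact Or.inl (hC _ h)
    · refine Or.inr ⟨d⁻¹, ⟨hC _ hd, by simpa using hdH⟩, c⁻¹, ⟨hC _ hc, by simpa using hcH⟩, ?_⟩
      simp only at hcd ⊢
      rw [← hcd, mul_inv_rev]
  loopless := ⟨fun _ h => h.1 rfl⟩

/-- Left translation as an automorphism of `shortcutGraph`. -/
def shortcutGraphMulLeft (H : Subgroup G) (C : Set G) (hC : ∀ c ∈ C, c⁻¹ ∈ C) (g : H) :
    shortcutGraph H C hC ≃g shortcutGraph H C hC where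
  toEquiv := Equiv.mulLeft g
  map_rel_iff' := by
    intro x y
    simp [shortcutGraph, mul_assoc]

lemma shortcutGraph_connected (hconn : (relCayley H C hC).Connected) :
    (shortcutGraph H C hC).Connected := by
  have key : ∀ (h : H) (x : G), (relCayley H C hC).Reachable h x → ∀ k : H,
      (x = k ∨ (x ∉ H ∧ (relCayley H C hC).Adj x k)) → (shortcutGraph H C hC).Reachable h k := by
    intro h x hx
    rw [SimpleGraph.reachable_iff_reflTransGen] at hx
    induction hx with
    | refl =>
      rintro k (hk | ⟨hk, -⟩)
      · rw [Subtype.ext hk]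
      · exact absurd h.2 hk
    | @tail x y _ hxy ih =>
      obtain ⟨hne, hor, hmem⟩ := id hxy
      rintro k (rfl | ⟨hy, hyne, -, hyk⟩)
      · by_cases hxH : x ∈ H
        · refine (ih ⟨x, hxH⟩ (Or.inl rfl)).trans (SimpleGraph.Adj.reachable ?_)
          exact ⟨fun e => hne (congrArg Subtype.val e), Or.inl hmem⟩
        · exact ih k (Or.inr ⟨hxH, hxy⟩)
      · have hxH : x ∈ H := hor.resolve_right hy
        have hx := ih ⟨x, hxH⟩ (Or.inl rfl)
        by_cases hxk : (⟨x, hxH⟩ : H) = k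
        · rwa [← hxk]
        · refine hx.trans (SimpleGraph.Adj.reachable ⟨hxk, Or.inr ?_⟩)
          refine ⟨x⁻¹ * y, ⟨hmem, ?_⟩, y⁻¹ * k, ⟨hyk, ?_⟩, by simp [mul_assoc]⟩
          · simpa [H.mul_mem_cancel_left (H.inv_mem hxH)] using hy
          · simpa [H.mul_mem_cancel_right k.2] using hy
  have : Nonempty H := ⟨1⟩
  exact ⟨fun h k => key h k (hconn _ _) k (Or.inl rfl)⟩

lemma relCayley_dist_le_two_of_shortcutGraph_adj {x y : H}
    (h : (shortcutGraph H C hC).Adj x y) : (relCayley H C hC).dist x y ≤ 2 := by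
  obtain ⟨hne, h | ⟨c, ⟨hc, hcH⟩, d, ⟨hd, hdH⟩, hcd⟩⟩ := h
  · have : (relCayley H C hC).Adj x y := ⟨fun e => hne (Subtype.ext e), Or.inl x.2, h⟩
    rw [SimpleGraph.dist_eq_one_iff_adj.2 this]
    norm_num
  · have hxc : (x : G) * c ∉ H := by rwa [H.mul_mem_cancel_left x.2]
    have hy : (y : G) = x * c * d := by
      simp only at hcd
      rw [mul_assoc, hcd, mul_inv_cancel_left]
    have hxz : (relCayley H C hC).Adj x (x * c) :=
      ⟨fun e => hxc (e ▸ x.2), Or.inl x.2, by simpa using hc⟩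
    have hzy : (relCayley H C hC).Adj (x * c) y :=
      ⟨fun e => hxc (e ▸ y.2), Or.inr y.2, by rwa [hy, inv_mul_cancel_left]⟩
    simpa using SimpleGraph.dist_le (SimpleGraph.Walk.cons hxz (.cons hzy .nil))

lemma exists_mem_relCayley_dist_le_one (hconn : (relCayley H C hC).Connected) (x : G) :
    ∃ h : H, (relCayley H C hC).dist x h ≤ 1 := by
  by_cases hx : x ∈ H
  · exact ⟨⟨x, hx⟩, by simp⟩
  · have : Nontrivial G := ⟨x, 1, fun e => hx (e ▸ H.one_mem)⟩
    obtain ⟨y, hy⟩ := hconn.preconnected.exists_adj_of_nontrivial x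
    exact ⟨⟨y, hy.2.1.resolve_left hx⟩, (SimpleGraph.dist_eq_one_iff_adj.2 hy).le⟩

/-- If the edges of `shortcutGraph` join vertices at distance at most `m` in the relative Cayley
graph, then the diameter of the latter is at most `m / 2 * |H| + 2`. -/
lemma two_mul_relCayley_diam_le [Finite G] (hconn : (relCayley H C hC).Connected) {m : ℕ}
    (hm : ∀ x y, (shortcutGraph H C hC).Adj x y → (relCayley H C hC).dist x y ≤ m) :
    2 * (relCayley H C hC).diam ≤ m * Nat.card H + 4 := by
  obtain ⟨x, y, hxy⟩ := (relCayley H C hC).exists_dist_eq_diam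
  obtain ⟨h, hh⟩ := exists_mem_relCayley_dist_le_one hconn x
  obtain ⟨k, hk⟩ := exists_mem_relCayley_dist_le_one hconn y
  have hS := shortcutGraph_connected hconn
  have hcard := hS.two_mul_dist_le_card_of_transitive
    (fun u v => ⟨shortcutGraphMulLeft H C hC (v * u⁻¹), by simp [shortcutGraphMulLeft]⟩) h k
  have hdist := hconn.dist_apply_le_mul_dist hS Subtype.val hm h k
  have hxk := hconn.dist_triangle (u := x) (v := h) (w := k)
  have hxy' := hconn.dist_triangle (u := x) (v := k) (w := y)
  rw [SimpleGraph.dist_comm] at hk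
  have := Nat.mul_le_mul_left m hcard
  rw [← hxy]
  linarith

end RelCayley

/-- Corollary 3.6 (last three bounds): if `Γ = Cay(G,H,C)` is connected, then
`diam(Γ) ≤ (3/2)|H| + 2`; moreover `diam(Γ) ≤ |H| + 2` when `H ∩ C = ∅`, and
`diam(Γ) ≤ (1/2)|H| + 2` when `H ∩ (C \ H)² = {1}`. -/
theorem statement9 {G : Type*} [Group G] [Finite G] (H : Subgroup G) (hH : H ≠ ⊤)
    (C : Set G) (h1 : (1 : G) ∉ C) (hC : ∀ c ∈ C, c⁻¹ ∈ C)
    (hconn : (relCayley H C hC).Connected) :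
    ((relCayley H C hC).diam : ℝ) ≤ (3 / 2 : ℝ) * Nat.card H + 2 ∧
    ((H : Set G) ∩ C = ∅ → (relCayley H C hC).diam ≤ Nat.card H + 2) ∧
    ((H : Set G) ∩ ((C \ (H : Set G)) * (C \ (H : Set G))) = {1} →
      ((relCayley H C hC).diam : ℝ) ≤ (1 / 2 : ℝ) * Nat.card H + 2) := by
  have hdiam := two_mul_relCayley_diam_le hconn
    fun _ _ h => relCayley_dist_le_two_of_shortcutGraph_adj h
  refine ⟨?_, fun _ => by omega, fun hB => ?_⟩
  · have : ((relCayley H C hC).diam : ℝ) ≤ Nat.card H + 2 := by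
      exact_mod_cast (by omega : (relCayley H C hC).diam ≤ Nat.card H + 2)
    have : (0 : ℝ) ≤ Nat.card H := Nat.cast_nonneg _
    linarith
  · have hle : 2 * (relCayley H C hC).diam ≤ 1 * Nat.card H + 4 := by
      refine two_mul_relCayley_diam_le hconn fun x y ⟨hne, h⟩ => ?_
      have hmem : (x : G)⁻¹ * y ∈ C := by
        refine h.resolve_right fun hmul => hne (Subtype.ext ?_)
        have : (x : G)⁻¹ * y ∈ ({1} : Set G) :=
          hB ▸ ⟨H.mul_mem (H.inv_mem x.2) y.2, hmul⟩
        exact inv_mul_eq_one.1 this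
      have hadj : (relCayley H C hC).Adj x y :=
        ⟨fun e => hne (Subtype.ext e), Or.inl x.2, hmem⟩
      exact (SimpleGraph.dist_eq_one_iff_adj.2 hadj).le
    have : (2 : ℝ) * (relCayley H C hC).diam ≤ 1 * Nat.card H + 4 := by exact_mod_cast hle
    linarith
end

section
/- The clique number satisfies ω(Γ) ≤ |H∩C| + 2, and equality holds if and only if (H∩C) ∪ {1} is a subgroup of G and H∩C ⊆ cC for some c ∈ C∖H. -/
open scoped Pointwise

theorem relCayley_smul_subset {G : Type*} [Group G] {H : Subgroup G} {C : Set G}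
    {hC : ∀ c ∈ C, c⁻¹ ∈ C} {T : Set G} (hT : (relCayley H C hC).IsClique T)
    (hTH : T ⊆ H) {h : G} (hh : h ∈ T) :
    h⁻¹ • T ⊆ insert (1 : G) ((H : Set G) ∩ C) := by
  rintro _ ⟨t, ht, rfl⟩
  by_cases hne : h = t
  · left
    simp [hne]
  · exact Or.inr ⟨H.mul_mem (H.inv_mem (hTH hh)) (hTH ht), (hT hh ht hne).2.2⟩

theorem relCayley_ncard_le_of_subset {G : Type*} [Group G] [Finite G] {H : Subgroup G} {C : Set G}
    {hC : ∀ c ∈ C, c⁻¹ ∈ C} {T : Set G} (hT : (relCayley H C hC).IsClique T)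
    (hTH : T ⊆ H) : T.ncard ≤ ((H : Set G) ∩ C).ncard + 1 := by
  rcases T.eq_empty_or_nonempty with rfl | ⟨h, hh⟩
  · simp
  · rw [← Set.ncard_smul_set h⁻¹ T]
    exact (Set.ncard_le_ncard (relCayley_smul_subset hT hTH hh)).trans (Set.ncard_insert_le _ _)

/-- A clique has at most one vertex outside `H`. -/
theorem relCayley_sdiff_singleton_subset {G : Type*} [Group G] {H : Subgroup G} {C : Set G}
    {hC : ∀ c ∈ C, c⁻¹ ∈ C} {S : Set G} (hS : (relCayley H C hC).IsClique S) {y : G}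
    (hy : y ∈ S) (hyH : y ∉ H) : S \ {y} ⊆ H := by
  rintro x ⟨hx, hxy⟩
  exact (hS hx hy hxy).2.1.resolve_right hyH

theorem relCayley_ncard_le {G : Type*} [Group G] [Finite G] {H : Subgroup G} {C : Set G}
    {hC : ∀ c ∈ C, c⁻¹ ∈ C} {S : Set G} (hS : (relCayley H C hC).IsClique S) :
    S.ncard ≤ ((H : Set G) ∩ C).ncard + 2 := by
  by_cases hSH : S ⊆ H
  · exact (relCayley_ncard_le_of_subset hS hSH).trans (Nat.le_succ _)
  · obtain ⟨y, hy, hyH⟩ := Set.not_subset.1 hSH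
    have hle := relCayley_ncard_le_of_subset (hS.subset Set.sdiff_subset)
      (relCayley_sdiff_singleton_subset hS hy hyH)
    have hcard := Set.ncard_sdiff_singleton_add_one hy
    omega

theorem relCayley_of_ncard_eq {G : Type*} [Group G] [Finite G] {H : Subgroup G} {C : Set G}
    (h1 : (1 : G) ∉ C) {hC : ∀ c ∈ C, c⁻¹ ∈ C} {S : Set G}
    (hS : (relCayley H C hC).IsClique S) (hcard : S.ncard = ((H : Set G) ∩ C).ncard + 2) :
    (∃ K : Subgroup G, (K : Set G) = insert (1 : G) ((H : Set G) ∩ C)) ∧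
      ∃ c ∈ C, c ∉ H ∧ (H : Set G) ∩ C ⊆ c • C := by
  have hSH : ¬ S ⊆ H := fun hSH => by
    have := relCayley_ncard_le_of_subset hS hSH
    omega
  obtain ⟨y, hy, hyH⟩ := Set.not_subset.1 hSH
  have hTH := relCayley_sdiff_singleton_subset hS hy hyH
  have hT : (relCayley H C hC).IsClique (S \ {y}) := hS.subset Set.sdiff_subset
  have hTcard := Set.ncard_sdiff_singleton_add_one hy
  have hK : ∀ h ∈ S \ {y}, h⁻¹ • (S \ {y}) = insert (1 : G) ((H : Set G) ∩ C) := fun h hh => by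
    refine Set.eq_of_subset_of_ncard_le (relCayley_smul_subset hT hTH hh) ?_
    rw [Set.ncard_smul_set, Set.ncard_insert_of_notMem fun h => h1 h.2]
    omega
  have hmul : ∀ h ∈ S \ {y}, ∀ a, a ∈ insert (1 : G) ((H : Set G) ∩ C) ↔ h * a ∈ S \ {y} :=
    fun h hh a => by rw [← hK h hh, Set.mem_inv_smul_set_iff, smul_eq_mul]
  obtain ⟨h, hh⟩ : (S \ {y}).Nonempty := Set.nonempty_of_ncard_ne_zero (by omega)
  have hadj : (relCayley H C hC).Adj h y := hS hh.1 hy hh.2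
  refine ⟨⟨{ carrier := insert (1 : G) ((H : Set G) ∩ C)
             one_mem' := Set.mem_insert _ _
             mul_mem' := fun {a b} ha hb => ?_
             inv_mem' := fun {a} ha => ?_ }, rfl⟩, h⁻¹ * y, hadj.2.2, fun hmem => hyH ?_, ?_⟩
  · have ha' := (hmul h hh a).1 ha
    rw [hmul h hh, ← mul_assoc]
    exact (hmul _ ha' b).1 hb
  · rcases ha with rfl | ha
    · simp
    · exact Or.inr ⟨H.inv_mem ha.1, hC _ ha.2⟩
  · exact (H.mul_mem_cancel_left (H.inv_mem (hTH hh))).1 hmem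
  · intro k hk
    have hk' := (hmul h hh k).1 (Or.inr hk)
    rw [Set.mem_smul_set_iff_inv_smul_mem, smul_eq_mul, mul_inv_rev, inv_inv, mul_assoc]
    exact (hS hy hk'.1 (Ne.symm hk'.2)).2.2

theorem relCayley_isClique_insert {G : Type*} [Group G] {H K : Subgroup G} {C : Set G}
    {hC : ∀ c ∈ C, c⁻¹ ∈ C} (hK : (K : Set G) = insert (1 : G) ((H : Set G) ∩ C))
    {c : G} (hc : c ∈ C) (hsub : (H : Set G) ∩ C ⊆ c • C) :
    (relCayley H C hC).IsClique (insert c (K : Set G)) := by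
  have hmem : ∀ k, k ∈ K ↔ k = 1 ∨ k ∈ H ∧ k ∈ C := fun k => by
    rw [← SetLike.mem_coe, hK]
    rfl
  have hKH : ∀ k ∈ K, k ∈ H := fun k hk => by
    rcases (hmem k).1 hk with rfl | hk
    exacts [H.one_mem, hk.1]
  refine SimpleGraph.IsClique.insert (fun x hx y hy hxy => ?_) fun k hk hne =>
    SimpleGraph.Adj.symm ⟨hne.symm, Or.inl (hKH k hk), ?_⟩
  · refine ⟨hxy, Or.inl (hKH x hx), ?_⟩
    rcases (hmem _).1 (K.mul_mem (K.inv_mem hx) hy) with h | h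
    exacts [absurd (inv_mul_eq_one.1 h) hxy, h.2]
  · rcases (hmem k).1 hk with rfl | hk
    · simpa using hc
    · have h := hsub hk
      rw [Set.mem_smul_set_iff_inv_smul_mem, smul_eq_mul] at h
      simpa using hC _ h

/-- Theorem 4.1: the clique number of `Γ = Cay(G,H,C)` satisfies `ω(Γ) ≤ |H ∩ C| + 2`, with
equality iff `(H ∩ C) ∪ {1}` is a subgroup of `G` and `H ∩ C ⊆ cC` for some `c ∈ C \ H`. -/
theorem statement10 {G : Type*} [Group G] [Finite G] (H : Subgroup G) (hH : H ≠ ⊤)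
    (C : Set G) (h1 : (1 : G) ∉ C) (hC : ∀ c ∈ C, c⁻¹ ∈ C) :
    (relCayley H C hC).cliqueNum ≤ ((H : Set G) ∩ C).ncard + 2 ∧
    ((relCayley H C hC).cliqueNum = ((H : Set G) ∩ C).ncard + 2 ↔
      ((∃ K : Subgroup G, (K : Set G) = insert (1 : G) ((H : Set G) ∩ C)) ∧
        ∃ c ∈ C, c ∉ H ∧ (H : Set G) ∩ C ⊆ c • C)) := by
  obtain ⟨s, hs⟩ := (relCayley H C hC).exists_isNClique_cliqueNum
  have hle : (relCayley H C hC).cliqueNum ≤ ((H : Set G) ∩ C).ncard + 2 := by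
    rw [← hs.card_eq, ← Set.ncard_coe_finset]
    exact relCayley_ncard_le hs.isClique
  refine ⟨hle, fun heq => ?_, ?_⟩
  · refine relCayley_of_ncard_eq h1 hs.isClique ?_
    rw [Set.ncard_coe_finset, hs.card_eq, heq]
  · rintro ⟨⟨K, hK⟩, c, hc, hcH, hsub⟩
    refine le_antisymm hle ?_
    have hcK : c ∉ (K : Set G) := by
      rw [hK]
      rintro (rfl | h)
      exacts [h1 hc, hcH h.1]
    have hclique := relCayley_isClique_insert (hC := hC) hK hc hsub
    have hfin := (insert c (K : Set G)).toFinite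
    rw [← hfin.coe_toFinset] at hclique
    have hcard := hclique.card_le_cliqueNum
    rw [← Set.ncard_eq_toFinset_card _ hfin, Set.ncard_insert_of_notMem hcK, hK,
      Set.ncard_insert_of_notMem fun h => h1 h.2] at hcard
    exact hcard
end

section
/- For every finite group G and every proper subgroup H of G, there exists an inverse-closed subset C of G∖{1} such that ω(Cay(G,H,C)) = |H∩C| + 2. -/
open scoped Pointwise

/-- Corollary 4.2: for every finite group `G` and proper subgroup `H`, there is an
inverse-closed subset `C` of `G \ {1}` with `ω(Cay(G,H,C)) = |H ∩ C| + 2`. -/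
theorem statement11 {G : Type*} [Group G] [Finite G] (H : Subgroup G) (hH : H ≠ ⊤) :
    ∃ (C : Set G) (_ : (1 : G) ∉ C) (hC : ∀ c ∈ C, c⁻¹ ∈ C),
      (relCayley H C hC).cliqueNum = ((H : Set G) ∩ C).ncard + 2 := by
  classical
  have := Fintype.ofFinite G
  have hC : ∀ c ∈ ({1}ᶜ : Set G), c⁻¹ ∈ ({1}ᶜ : Set G) := by simp
  refine ⟨{1}ᶜ, by simp, hC, ?_⟩
  have hadj : ∀ x y, (relCayley H {1}ᶜ hC).Adj x y ↔ x ≠ y ∧ (x ∈ H ∨ y ∈ H) := by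
    intro x y
    simp only [relCayley, Set.mem_compl_iff, Set.mem_singleton_iff, inv_mul_eq_one]
    tauto
  let K : Finset G := Finset.univ.filter (· ∈ H)
  have hcard : ((H : Set G) ∩ {1}ᶜ).ncard + 1 = K.card := by
    have hK : (H : Set G) = K := by ext; simp [K]
    rw [← Set.sdiff_eq, Set.ncard_sdiff_singleton_add_one H.one_mem, hK, Set.ncard_coe_finset]
  suffices h : (relCayley H {1}ᶜ hC).cliqueNum = K.card + 1 by omega
  apply le_antisymm
  · obtain ⟨s, hs⟩ := (relCayley H {1}ᶜ hC).exists_isNClique_cliqueNum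
    have houtside : (s \ K).card ≤ 1 := by
      rw [Finset.card_le_one]
      intro a ha b hb
      simp only [K, Finset.mem_sdiff, Finset.mem_filter, Finset.mem_univ, true_and] at ha hb
      by_contra hab
      have := ((hadj a b).1 (hs.isClique ha.1 hb.1 hab)).2
      tauto
    have hsplit := Finset.card_sdiff_add_card_inter s K
    have hinside : (s ∩ K).card ≤ K.card := Finset.card_le_card Finset.inter_subset_right
    have := hs.card_eq
    omega
  · obtain ⟨g, hg⟩ : ∃ g, g ∉ H := by
      by_contra! h
      exact hH ((Subgroup.eq_top_iff' H).2 h)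
    have hgK : g ∉ K := by simpa [K] using hg
    rw [← Finset.card_insert_of_notMem hgK]
    apply SimpleGraph.IsClique.card_le_cliqueNum
    intro x hx y hy hxy
    rw [hadj]
    simp only [K, Finset.coe_insert, Set.mem_insert_iff, Finset.mem_coe, Finset.mem_filter,
      Finset.mem_univ, true_and] at hx hy
    refine ⟨hxy, ?_⟩
    rcases hx with rfl | hx
    · rcases hy with rfl | hy
      · exact absurd rfl hxy
      · exact Or.inr hy
    · exact Or.inl hx
end

section
/- Assume C∖H ≠ ∅. Then: (i) the independence number of Γ equals |G| − |H| (the maximum size of a set of pairwise non-adjacent vertices is |G∖H|); (ii) the matching number of Γ equals |H| (the maximum size of a set of pairwise disjoint edges is |H|); (iii) the minimum size of a vertex cover of Γ equals |H|; (iv) if moreover G = HC*, then the minimum size of an edge cover of Γ (a set of edges covering all vertices) equals |G| − |H|. -/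
open scoped Pointwise

namespace SimpleGraph

variable {V : Type*} [Finite V] {Γ : SimpleGraph V} {S : Set V} {f : V → V}

/-- If `f` matches `S` into its complement, every vertex cover has at least `|S|` elements. -/
theorem ncard_le_ncard_of_cover (hf : ∀ x ∈ S, Γ.Adj x (f x)) (hfS : ∀ x ∈ S, f x ∉ S)
    (hinj : Set.InjOn f S) {t : Set V} (ht : ∀ x y, Γ.Adj x y → x ∈ t ∨ y ∈ t) :
    S.ncard ≤ t.ncard := by
  classical
  refine Set.ncard_le_ncard_of_injOn (fun x => if x ∈ t then x else f x) ?_ ?_ t.toFinite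
  · intro x hx
    have := ht _ _ (hf x hx)
    split_ifs <;> tauto
  · intro x hx y hy hxy
    dsimp only at hxy
    split_ifs at hxy
    · exact hxy
    · exact absurd (hxy ▸ hx) (hfS y hy)
    · exact absurd (hxy ▸ hy) (hfS x hx)
    · exact hinj hx hy hxy

/-- If `f` matches `S` into its complement, an independent set has at most `|V| - |S|` elements. -/
theorem ncard_le_of_independent (hf : ∀ x ∈ S, Γ.Adj x (f x)) (hfS : ∀ x ∈ S, f x ∉ S)
    (hinj : Set.InjOn f S) {s : Set V} (hs : ∀ x ∈ s, ∀ y ∈ s, ¬ Γ.Adj x y) :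
    s.ncard ≤ Nat.card V - S.ncard := by
  have h : S.ncard ≤ sᶜ.ncard := ncard_le_ncard_of_cover hf hfS hinj fun x y hxy => by
    by_contra! h
    exact hs x (not_not.1 h.1) y (not_not.1 h.2) hxy
  have := Set.ncard_add_ncard_compl s
  omega

/-- A matching has at most as many edges as a vertex cover has elements. -/
theorem Subgraph.IsMatching.ncard_edgeSet_le (hS : ∀ x y, Γ.Adj x y → x ∈ S ∨ y ∈ S)
    {M : Γ.Subgraph} (hM : M.IsMatching) : M.edgeSet.ncard ≤ S.ncard := by
  classical
  have hsub : M.edgeSet ⊆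
      (fun x => if h : ∃ w, M.Adj x w then s(x, h.choose) else s(x, x)) '' S := by
    have key : ∀ x y, M.Adj x y →
        (if h : ∃ w, M.Adj x w then s(x, h.choose) else s(x, x)) = s(x, y) := by
      intro x y hxy
      have h : ∃ w, M.Adj x w := ⟨y, hxy⟩
      rw [dif_pos h, (hM (M.edge_vert hxy)).unique h.choose_spec hxy]
    intro e he
    induction e using Sym2.ind with
    | _ x y =>
      rw [Subgraph.mem_edgeSet] at he
      rcases hS x y he.adj_sub with h | h
      · exact ⟨x, h, key x y he⟩
      · exact ⟨y, h, (key y x he.symm).trans Sym2.eq_swap⟩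
  exact (Set.ncard_le_ncard hsub (Set.toFinite _)).trans (Set.ncard_image_le S.toFinite)

/-- If `f` matches `S` into its complement, there is a matching with at least `|S|` edges. -/
theorem exists_isMatching_le_ncard (hf : ∀ x ∈ S, Γ.Adj x (f x)) (hfS : ∀ x ∈ S, f x ∉ S)
    (hinj : Set.InjOn f S) : ∃ M : Γ.Subgraph, M.IsMatching ∧ S.ncard ≤ M.edgeSet.ncard := by
  let M : Γ.Subgraph :=
    { verts := S ∪ f '' S
      Adj := fun x y => (x ∈ S ∧ f x = y) ∨ (y ∈ S ∧ f y = x)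
      adj_sub := by
        rintro x y (⟨h, rfl⟩ | ⟨h, rfl⟩)
        · exact hf _ h
        · exact (hf _ h).symm
      edge_vert := by
        rintro x y (⟨h, rfl⟩ | ⟨h, rfl⟩)
        · exact Or.inl h
        · exact Or.inr ⟨y, h, rfl⟩
      symm := ⟨fun _ _ h => h.symm⟩ }
  refine ⟨M, ?_, ?_⟩
  · rintro v (hv | ⟨u, hu, rfl⟩)
    · refine ⟨f v, Or.inl ⟨hv, rfl⟩, ?_⟩
      rintro y (⟨-, rfl⟩ | ⟨hy, rfl⟩)
      · rfl
      · exact absurd hv (hfS y hy)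
    · refine ⟨u, Or.inr ⟨hu, rfl⟩, ?_⟩
      rintro y (⟨h, -⟩ | ⟨hy, h⟩)
      · exact absurd h (hfS u hu)
      · exact hinj hy hu h
  · refine Set.ncard_le_ncard_of_injOn (fun x => s(x, f x)) ?_ ?_ (Set.toFinite _)
    · intro x hx
      exact Subgraph.mem_edgeSet.2 (Or.inl ⟨hx, rfl⟩)
    · intro x hx y hy hxy
      rcases Sym2.eq_iff.1 hxy with h | h
      · exact h.1
      · exact absurd (h.1 ▸ hx) (hfS y hy)

/-- An edge cover has at least as many elements as the complement of a vertex cover. -/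
theorem ncard_compl_le_of_edgeCover (hS : ∀ x y, Γ.Adj x y → x ∈ S ∨ y ∈ S)
    {E : Set (Sym2 V)} (hE : E ⊆ Γ.edgeSet) (hcov : ∀ v, ∃ e ∈ E, v ∈ e) :
    Sᶜ.ncard ≤ E.ncard := by
  choose g hgE hg using hcov
  refine Set.ncard_le_ncard_of_injOn g (fun x _ => hgE x) ?_ E.toFinite
  intro x hx y hy hxy
  by_contra hne
  have he : g x = s(x, y) := (Sym2.mem_and_mem_iff hne).1 ⟨hg x, hxy ▸ hg y⟩
  have hadj : Γ.Adj x y := by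
    rw [← mem_edgeSet, ← he]
    exact hE (hgE x)
  exact (hS x y hadj).elim hx hy

/-- If `f` matches `S` into its complement and every vertex outside `S` has a neighbour,
there is an edge cover with at most `|Sᶜ|` elements. -/
theorem exists_edgeCover_ncard_le (hf : ∀ x ∈ S, Γ.Adj x (f x)) (hfS : ∀ x ∈ S, f x ∉ S)
    (hinj : Set.InjOn f S) (hdom : ∀ v ∉ S, ∃ u, Γ.Adj v u) :
    ∃ E ⊆ Γ.edgeSet, (∀ v, ∃ e ∈ E, v ∈ e) ∧ E.ncard ≤ Sᶜ.ncard := by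
  have hp : ∀ v, ∃ u, v ∉ S → Γ.Adj v u ∧ ∀ x ∈ S, f x = v → u = x := by
    intro v
    by_cases hv : ∃ x ∈ S, f x = v
    · obtain ⟨x, hx, rfl⟩ := hv
      exact ⟨x, fun _ => ⟨(hf x hx).symm, fun y hy hyx => hinj hx hy hyx.symm⟩⟩
    · by_cases hvS : v ∈ S
      · exact ⟨v, fun h => absurd hvS h⟩
      · obtain ⟨u, hu⟩ := hdom v hvS
        exact ⟨u, fun _ => ⟨hu, fun x hx hxv => absurd ⟨x, hx, hxv⟩ hv⟩⟩
  choose p hp using hp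
  refine ⟨(fun v => s(v, p v)) '' Sᶜ, ?_, ?_, Set.ncard_image_le (Set.toFinite _)⟩
  · rintro _ ⟨v, hv, rfl⟩
    exact (hp v hv).1
  · intro v
    by_cases hv : v ∈ S
    · refine ⟨_, ⟨f v, hfS v hv, rfl⟩, ?_⟩
      dsimp only
      rw [(hp _ (hfS v hv)).2 v hv rfl]
      exact Sym2.mem_mk_right _ _
    · exact ⟨_, ⟨v, hv, rfl⟩, Sym2.mem_mk_left _ _⟩

end SimpleGraph

/-- Theorem 4.5: for `Γ = Cay(G,H,C)` with `C \ H ≠ ∅`: (i) the independence number is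
`|G| - |H|`; (ii) the matching number is `|H|`; (iii) the minimum size of a vertex cover is
`|H|`; (iv) if moreover `G = HC*`, the minimum size of an edge cover is `|G| - |H|`. -/
theorem statement13 {G : Type*} [Group G] [Finite G] (H : Subgroup G) (hH : H ≠ ⊤)
    (C : Set G) (h1 : (1 : G) ∉ C) (hC : ∀ c ∈ C, c⁻¹ ∈ C)
    (hCH : (C \ (H : Set G)).Nonempty) :
    -- (i) independence number
    sSup {n | ∃ s : Set G,
        (∀ x ∈ s, ∀ y ∈ s, ¬ (relCayley H C hC).Adj x y) ∧ s.ncard = n}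
      = Nat.card G - Nat.card H ∧
    -- (ii) matching number
    sSup {n | ∃ M : (relCayley H C hC).Subgraph, M.IsMatching ∧ M.edgeSet.ncard = n}
      = Nat.card H ∧
    -- (iii) minimum vertex cover
    sInf {n | ∃ s : Set G,
        (∀ x y : G, (relCayley H C hC).Adj x y → x ∈ s ∨ y ∈ s) ∧ s.ncard = n}
      = Nat.card H ∧
    -- (iv) minimum edge cover, assuming `G = HC*`
    ((H : Set G) * insert (1 : G) C = Set.univ →
      sInf {n | ∃ E : Set (Sym2 G), E ⊆ (relCayley H C hC).edgeSet ∧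
          (∀ v : G, ∃ e ∈ E, v ∈ e) ∧ E.ncard = n}
        = Nat.card G - Nat.card H) := by
  obtain ⟨c, hcC, hcH⟩ := hCH
  have hS : ∀ x y, (relCayley H C hC).Adj x y → x ∈ (H : Set G) ∨ y ∈ (H : Set G) :=
    fun x y h => h.2.1
  have hfS : ∀ x ∈ (H : Set G), x * c ∉ (H : Set G) :=
    fun x hx h => hcH ((H.mul_mem_cancel_left hx).1 h)
  have hf : ∀ x ∈ (H : Set G), (relCayley H C hC).Adj x (x * c) :=
    fun x hx => ⟨fun h => hfS x hx (h ▸ hx), Or.inl hx, by simpa using hcC⟩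
  have hinj : Set.InjOn (· * c) (H : Set G) := (mul_left_injective c).injOn
  have hcard : (H : Set G).ncard = Nat.card H := rfl
  have hcompl : (H : Set G)ᶜ.ncard = Nat.card G - Nat.card H := by
    rw [Set.ncard_compl, hcard]
  refine ⟨IsGreatest.csSup_eq ⟨⟨(H : Set G)ᶜ, ?_, hcompl⟩, ?_⟩,
    IsGreatest.csSup_eq ⟨?_, ?_⟩, IsLeast.csInf_eq ⟨⟨H, hS, hcard⟩, ?_⟩,
    fun hG => IsLeast.csInf_eq ⟨?_, ?_⟩⟩
  · exact fun x hx y hy h => (hS x y h).elim hx hy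
  · rintro _ ⟨s, hs, rfl⟩
    exact SimpleGraph.ncard_le_of_independent hf hfS hinj hs
  · obtain ⟨M, hM, hle⟩ := SimpleGraph.exists_isMatching_le_ncard hf hfS hinj
    exact ⟨M, hM, (hM.ncard_edgeSet_le hS).antisymm hle⟩
  · rintro _ ⟨M, hM, rfl⟩
    exact hM.ncard_edgeSet_le hS
  · rintro _ ⟨t, ht, rfl⟩
    exact SimpleGraph.ncard_le_ncard_of_cover hf hfS hinj ht
  · have hdom : ∀ v ∉ (H : Set G), ∃ u, (relCayley H C hC).Adj v u := by
      intro v hv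
      obtain ⟨h, hh, d, hd, rfl⟩ := Set.mem_mul.1 (hG ▸ Set.mem_univ v)
      rcases hd with rfl | hd
      · exact absurd (by simpa using hh) hv
      · exact ⟨h, fun e => hv (Set.mem_of_eq_of_mem e hh), Or.inr hh, by simpa using hC d hd⟩
    obtain ⟨E, hE, hcov, hle⟩ := SimpleGraph.exists_edgeCover_ncard_le hf hfS hinj hdom
    exact ⟨E, hE, hcov, hcompl ▸ hle.antisymm (SimpleGraph.ncard_compl_le_of_edgeCover hS hE hcov)⟩
  · rintro _ ⟨E, hE, hcov, rfl⟩
    exact hcompl ▸ SimpleGraph.ncard_compl_le_of_edgeCover hS hE hcov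
end

section
/- The chromatic number of Γ satisfies χ(Γ) ≤ |H∩C| + 2. -/
open scoped Pointwise

/-- Greedy colouring of a finite set of vertices of a subgroup: every vertex has at most
`|H ∩ C|` neighbours inside `H`, so `|H ∩ C| + 1` colours suffice. -/
lemma relCayley_exists_greedy_coloring {G : Type*} [Group G] [Finite G] (H : Subgroup G)
    (C : Set G) (hC : ∀ c ∈ C, c⁻¹ ∈ C) (S : Finset G) :
    ∃ f : G → Fin (((H : Set G) ∩ C).ncard + 1),
      ∀ x ∈ S, ∀ y ∈ S, x ∈ H → y ∈ H → (relCayley H C hC).Adj x y → f x ≠ f y := by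
  classical
  induction S using Finset.induction_on with
  | empty => exact ⟨fun _ => 0, by simp⟩
  | insert a S ha ih =>
    obtain ⟨f, hf⟩ := ih
    obtain ⟨k, hk⟩ : ∃ k, k ∉ (fun c => f (a * c)) '' ((H : Set G) ∩ C) := by
      by_contra! h
      have hle := Set.ncard_image_le (f := fun c => f (a * c)) (((H : Set G) ∩ C).toFinite)
      rw [Set.eq_univ_of_forall h, Set.ncard_univ, Nat.card_fin] at hle
      omega
    have hfree : ∀ y ∈ H, a ∈ H → (relCayley H C hC).Adj a y → k ≠ f y := by
      rintro y hy haH ⟨-, -, hay⟩ rfl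
      exact hk ⟨a⁻¹ * y, ⟨H.mul_mem (H.inv_mem haH) hy, hay⟩, by simp⟩
    refine ⟨Function.update f a k, fun x hx y hy hxH hyH hxy => ?_⟩
    rcases eq_or_ne x a with rfl | hxa
    · rw [Function.update_self, Function.update_of_ne hxy.ne']
      exact hfree y hyH hxH hxy
    · rcases eq_or_ne y a with rfl | hya
      · rw [Function.update_self, Function.update_of_ne hxa]
        exact (hfree x hxH hyH hxy.symm).symm
      · rw [Function.update_of_ne hxa, Function.update_of_ne hya]
        exact hf x (Finset.mem_of_mem_insert_of_ne hx hxa) y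
          (Finset.mem_of_mem_insert_of_ne hy hya) hxH hyH hxy

/-- Theorem 4.9 (inequality): the chromatic number of `Γ = Cay(G,H,C)` satisfies
`χ(Γ) ≤ |H ∩ C| + 2`. -/
theorem statement15 {G : Type*} [Group G] [Finite G] (H : Subgroup G) (hH : H ≠ ⊤)
    (C : Set G) (h1 : (1 : G) ∉ C) (hC : ∀ c ∈ C, c⁻¹ ∈ C) :
    (relCayley H C hC).chromaticNumber ≤ (((H : Set G) ∩ C).ncard + 2 : ℕ) := by
  classical
  have := Fintype.ofFinite G
  obtain ⟨f, hf⟩ := relCayley_exists_greedy_coloring H C hC Finset.univ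
  -- The vertices outside `H` form an independent set and share one extra colour.
  let col : (relCayley H C hC).Coloring (Option (Fin (((H : Set G) ∩ C).ncard + 1))) :=
    SimpleGraph.Coloring.mk (fun x => if x ∈ H then some (f x) else none) (by
      intro x y hxy
      by_cases hx : x ∈ H <;> by_cases hy : y ∈ H
      · simpa [hx, hy] using hf x (Finset.mem_univ x) y (Finset.mem_univ y) hx hy hxy
      · simp [hx, hy]
      · simp [hx, hy]
      · exact absurd hxy.2.1 (by simp [hx, hy]))
  have hcol := col.colorable
  simp only [Fintype.card_option, Fintype.card_fin] at hcol
  exact hcol.chromaticNumber_le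
end

section
/- Γ is a forest (contains no cycles) if and only if H ∩ C² ⊆ {1} and H∩C is either empty or equal to {c} for some involution c (c² = 1, c ≠ 1). -/
open scoped Pointwise

/-- A nonempty finite acyclic graph has a vertex with at most one neighbor. -/
theorem SimpleGraph.IsAcyclic.exists_neighbors_subsingleton {V : Type*} [Finite V] [Nonempty V]
    {Γ : SimpleGraph V} (hΓ : Γ.IsAcyclic) : ∃ v, (Γ.neighborSet v).Subsingleton := by
  obtain ⟨u, v, p, hp, hmax⟩ := SimpleGraph.Walk.exists_isPath_forall_isPath_length_le_length Γ
  have eq_snd : ∀ w, Γ.Adj u w → w = p.snd := by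
    intro w hw
    refine hΓ.eq_snd_of_adj_start hp hw (by_contra fun hmem => ?_)
    have := hmax _ _ _ (hp.cons hmem (h := hw.symm))
    simp at this
  exact ⟨u, fun a ha b hb => (eq_snd a ha).trans (eq_snd b hb).symm⟩

/-- If `a, b ∈ C` and `a * b ∈ H` is nontrivial, then every vertex of `H ∪ H a` has two neighbors
in `H ∪ H a`; hence in the acyclic case `a * b = 1`. -/
theorem mul_eq_one_of_relCayley_isAcyclic {G : Type*} [Group G] [Finite G] {H : Subgroup G}
    {C : Set G} (h1 : (1 : G) ∉ C) {hC : ∀ c ∈ C, c⁻¹ ∈ C}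
    (hΓ : (relCayley H C hC).IsAcyclic) {a b : G} (ha : a ∈ C) (hb : b ∈ C)
    (hab : a * b ∈ H) : a * b = 1 := by
  have adj : ∀ x ∈ H, ∀ c ∈ C, (relCayley H C hC).Adj x (x * c) := fun x hx c hc =>
    ⟨fun h => h1 (by rwa [left_eq_mul.mp h] at hc), Or.inl hx, by simpa using hc⟩
  let S : Set G := {x | x ∈ H ∨ x * a⁻¹ ∈ H}
  have : Nonempty S := ⟨1, Or.inl H.one_mem⟩
  obtain ⟨⟨x, hx⟩, hsub⟩ := (hΓ.induce S).exists_neighbors_subsingleton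
  have key : ∀ y ∈ S, ∀ z ∈ S, (relCayley H C hC).Adj x y → (relCayley H C hC).Adj x z →
      y = z := fun y hy z hz hxy hxz =>
    congrArg Subtype.val (hsub (x := ⟨y, hy⟩) hxy (y := ⟨z, hz⟩) hxz)
  rcases hx with hx | hx
  · have := key (x * a) (Or.inr (by simpa using hx)) (x * b⁻¹)
      (Or.inr (by simpa [mul_assoc] using H.mul_mem hx (H.inv_mem hab)))
      (adj x hx a ha) (adj x hx _ (hC b hb))
    rw [mul_left_cancel this, inv_mul_cancel]
  · have hx' : x * b ∈ H := by simpa [mul_assoc] using H.mul_mem hx hab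
    have := key (x * a⁻¹) (Or.inl hx) (x * b) (Or.inl hx')
      (by simpa using (adj _ hx a ha).symm) (by simpa using (adj _ hx' _ (hC b hb)).symm)
    rw [← mul_left_cancel this, mul_inv_cancel]

/-- If `H ∩ C²` is trivial, then every vertex has at most one neighbor in `H`. -/
theorem relCayley_adj_unique {G : Type*} [Group G] {H : Subgroup G} {C : Set G}
    {hC : ∀ c ∈ C, c⁻¹ ∈ C} (hHC : (H : Set G) ∩ (C * C) ⊆ {1}) {x y z : G}
    (hy : y ∈ H) (hz : z ∈ H) (hxy : (relCayley H C hC).Adj x y)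
    (hxz : (relCayley H C hC).Adj x z) : y = z := by
  have hmem : y⁻¹ * z ∈ (H : Set G) ∩ (C * C) :=
    ⟨H.mul_mem (H.inv_mem hy) hz, y⁻¹ * x, hxy.symm.2.2, x⁻¹ * z, hxz.2.2, by simp [mul_assoc]⟩
  exact inv_mul_eq_one.mp (hHC hmem)

theorem relCayley_isAcyclic {G : Type*} [Group G] {H : Subgroup G} {C : Set G}
    {hC : ∀ c ∈ C, c⁻¹ ∈ C} (hHC : (H : Set G) ∩ (C * C) ⊆ {1}) :
    (relCayley H C hC).IsAcyclic := by
  intro u p hp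
  have two_neighbors : ∀ x ∈ p.support, ∃ y ∈ p.support, ∃ z ∈ p.support, y ≠ z ∧
      (relCayley H C hC).Adj x y ∧ (relCayley H C hC).Adj x z := by
    intro x hx
    obtain ⟨y, z, hne, heq⟩ := Set.ncard_eq_two.mp (hp.ncard_neighborSet_toSubgraph_eq_two hx)
    have hy : p.toSubgraph.Adj x y := by
      rw [← SimpleGraph.Subgraph.mem_neighborSet, heq]; simp
    have hz : p.toSubgraph.Adj x z := by
      rw [← SimpleGraph.Subgraph.mem_neighborSet, heq]; simp
    exact ⟨y, p.mem_verts_toSubgraph.mp hy.snd_mem, z, p.mem_verts_toSubgraph.mp hz.snd_mem,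
      hne, hy.adj_sub, hz.adj_sub⟩
  have support_subset : ∀ x ∈ p.support, x ∈ H := by
    intro x hx
    obtain ⟨y, -, z, -, hne, hxy, hxz⟩ := two_neighbors x hx
    by_contra hxH
    exact hne (relCayley_adj_unique hHC (hxy.2.1.resolve_left hxH) (hxz.2.1.resolve_left hxH)
      hxy hxz)
  obtain ⟨y, hy, z, hz, hne, hxy, hxz⟩ := two_neighbors u p.start_mem_support
  exact hne (relCayley_adj_unique hHC (support_subset y hy) (support_subset z hz) hxy hxz)

/-- Lemma 5.2 ((i) ⟺ (iii)): `Γ = Cay(G,H,C)` is a forest iff `H ∩ C² ⊆ {1}` and `H ∩ C` is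
either empty or `{c}` for an involution `c`. -/
theorem statement17 {G : Type*} [Group G] [Finite G] (H : Subgroup G) (hH : H ≠ ⊤)
    (C : Set G) (h1 : (1 : G) ∉ C) (hC : ∀ c ∈ C, c⁻¹ ∈ C) :
    (relCayley H C hC).IsAcyclic ↔
      ((H : Set G) ∩ (C * C) ⊆ {1} ∧
        ((H : Set G) ∩ C = ∅ ∨
          ∃ c : G, c ≠ 1 ∧ c * c = 1 ∧ (H : Set G) ∩ C = {c})) := by
  refine ⟨fun hΓ => ?_, fun h => relCayley_isAcyclic h.1⟩
  refine ⟨?_, (Set.eq_empty_or_nonempty _).imp_right ?_⟩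
  · rintro _ ⟨hmem, a, ha, b, hb, rfl⟩
    exact mul_eq_one_of_relCayley_isAcyclic h1 hΓ ha hb hmem
  · rintro ⟨c, hcH, hcC⟩
    refine ⟨c, fun h => h1 (h ▸ hcC),
      mul_eq_one_of_relCayley_isAcyclic h1 hΓ hcC hcC (H.mul_mem hcH hcH), ?_⟩
    refine Set.eq_singleton_iff_unique_mem.mpr ⟨⟨hcH, hcC⟩, fun d hd => ?_⟩
    exact mul_inv_eq_one.mp (mul_eq_one_of_relCayley_isAcyclic h1 hΓ hd.2 (hC c hcC)
      (H.mul_mem hd.1 (H.inv_mem hcH)))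
end
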